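/- arXiv:2602.19394 — 6 statements merged into one kernel-verified Lean document; each statement's English description precedes it below -/
import Mathlib

section
/- Set Ŝ_n := ∑_{w∈W_n} H^(n)_w · p̄^(n)_w (a sum in [0,∞]). Then Ŝ_0 = 1 and, for every n, Ŝ_{n+1} = Ŝ_n + ∑_{v∈W_{n+1}} ∑_{w∈V_n∖W_n} f^(n)_{v,w} · H^(n)_w · p̄^(n+1)_v; in particular (Ŝ_n) is non-decreasing and the extension value satisfies V̂ = 1 + ∑_{n=0}^∞ ∑_{v∈W_{n+1}} ∑_{w∈V_n∖W_n} f^(n)_{v,w} · H^(n)_w · p̄^(n+1)_v in [0,∞]. Consequently V̂ < ∞ if and only if this triple series is finite. (Paper: Theorem 3.4, criterion for finiteness of the measure extension from a vertex subdiagram.) -/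
open scoped ENNReal

/-- **Criterion for finiteness of the measure extension from a vertex subdiagram**
(Theorem 3.4).  The partial masses `Ŝ n = ∑_{w ∈ W n} H n w * p n w` start at `1`,
increase at each step by the triple sum over newly attached paths, and the total
extension value `⨆ n, Ŝ n = 1 + ∑ D n` is finite iff the triple series is. -/
theorem stmt_0
    (V : ℕ → Type) [∀ n, Countable (V n)] [∀ n, Nonempty (V n)]
    (f : ∀ n, V (n + 1) → V n → ℕ)
    (hrow : ∀ (n : ℕ) (v : V (n + 1)),
      (Function.support (f n v)).Finite ∧ (Function.support (f n v)).Nonempty)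
    (H : ∀ n, V n → ℝ≥0∞)
    (hH0 : ∀ v, H 0 v = 1)
    (hHrec : ∀ (n : ℕ) (v : V (n + 1)),
      H (n + 1) v = ∑' w : V n, (f n v w : ℝ≥0∞) * H n w)
    (W : ∀ n, Set (V n))
    (hWne : ∀ n, (W n).Nonempty)
    (hWadm : ∀ n, ∀ v ∈ W (n + 1), ∃ w ∈ W n, 0 < f n v w)
    (p : ∀ n, V n → ℝ≥0∞)
    (hp : ∀ n, ∀ w ∈ W n,
      p n w = ∑' v : W (n + 1), (f n v.1 w : ℝ≥0∞) * p (n + 1) v.1)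
    (hp0 : ∑' w : W 0, p 0 w.1 = 1)
    (S : ℕ → ℝ≥0∞)
    (hS : ∀ n, S n = ∑' w : W n, H n w.1 * p n w.1)
    (D : ℕ → ℝ≥0∞)
    (hD : ∀ n, D n = ∑' v : W (n + 1), ∑' w : ↥((W n)ᶜ),
        (f n v.1 w.1 : ℝ≥0∞) * H n w.1 * p (n + 1) v.1) :
    S 0 = 1 ∧
    (∀ n, S (n + 1) = S n + D n) ∧
    Monotone S ∧
    (⨆ n, S n) = 1 + ∑' n, D n ∧
    ((⨆ n, S n) < ⊤ ↔ (∑' n, D n) < ⊤) := by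
  have hS0 : S 0 = 1 := by
    simp only [hS, hH0, one_mul, hp0]
  have hstep : ∀ n, S (n + 1) = S n + D n := by
    intro n
    have hsplit : ∀ v : W (n + 1), H (n + 1) v.1 * p (n + 1) v.1 =
        (∑' w : W n, (f n v.1 w.1 : ℝ≥0∞) * H n w.1 * p (n + 1) v.1) +
          ∑' w : ↥((W n)ᶜ), (f n v.1 w.1 : ℝ≥0∞) * H n w.1 * p (n + 1) v.1 := by
      intro v
      rw [hHrec, ← ENNReal.tsum_mul_right]
      exact (ENNReal.summable.tsum_add_tsum_compl ENNReal.summable).symm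
    rw [hS (n + 1), tsum_congr hsplit, ENNReal.tsum_add, ← hD n, ENNReal.tsum_comm, hS n]
    congr 1
    refine tsum_congr fun w => ?_
    rw [hp n w.1 w.2, ← ENNReal.tsum_mul_left]
    exact tsum_congr fun v => by ring
  have hmono : Monotone S := monotone_nat_of_le_succ fun n => by
    rw [hstep n]
    exact le_self_add
  have hpartial : ∀ n, S n = 1 + ∑ i ∈ Finset.range n, D i := by
    intro n
    induction n with
    | zero => simp [hS0]
    | succ n ih => rw [hstep, ih, Finset.sum_range_succ, add_assoc]
  have hsup : (⨆ n, S n) = 1 + ∑' n, D n := by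
    rw [ENNReal.tsum_eq_iSup_nat, ENNReal.add_iSup]
    exact iSup_congr hpartial
  refine ⟨hS0, hstep, hmono, hsup, ?_⟩
  rw [hsup, ENNReal.add_lt_top]
  simp
end

section
/- Define the stochastic entries q^(n)_{v,w} := f^(n)_{v,w} · H^(n)_w / H^(n+1)_v (note H^(n)_v ≥ 1 for all n, v) and set ε_n := sup_{v∈W_{n+1}} ∑_{w∈V_n∖W_n} q^(n)_{v,w}. If ε_n < 1 for every n and ∑_{n=0}^∞ ε_n < ∞, then for EVERY encoded tail-invariant probability measure p̄ on the vertex subdiagram the extension value V̂ is finite. (Paper: Theorem 3.5, sufficient condition for finiteness of the measure extension in terms of the stochastic incidence matrices.) -/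
open scoped ENNReal

/-- The heights of a generalized Bratteli diagram are finite. -/
theorem height_ne_top (V : ℕ → Type) (f : ∀ n, V (n + 1) → V n → ℕ)
    (hfin : ∀ (n : ℕ) (v : V (n + 1)), (Function.support (f n v)).Finite)
    (H : ∀ n, V n → ℝ≥0∞) (hH0 : ∀ v, H 0 v = 1)
    (hHrec : ∀ (n : ℕ) (v : V (n + 1)),
      H (n + 1) v = ∑' w : V n, (f n v w : ℝ≥0∞) * H n w) (n : ℕ) (v : V n) :
    H n v ≠ ⊤ := by
  induction n with
  | zero => simp [hH0]
  | succ n ih =>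
    rw [hHrec, tsum_eq_sum (s := (hfin n v).toFinset)]
    · exact ENNReal.sum_ne_top.2 fun w _ => ENNReal.mul_ne_top (ENNReal.natCast_ne_top _) (ih w)
    · intro w hw
      have : f n v w = 0 := by simpa using hw
      simp [this]

/-- The heights of a generalized Bratteli diagram are nonzero. -/
theorem height_ne_zero (V : ℕ → Type) (f : ∀ n, V (n + 1) → V n → ℕ)
    (hne : ∀ (n : ℕ) (v : V (n + 1)), (Function.support (f n v)).Nonempty)
    (H : ∀ n, V n → ℝ≥0∞) (hH0 : ∀ v, H 0 v = 1)
    (hHrec : ∀ (n : ℕ) (v : V (n + 1)),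
      H (n + 1) v = ∑' w : V n, (f n v w : ℝ≥0∞) * H n w) (n : ℕ) (v : V n) :
    H n v ≠ 0 := by
  induction n with
  | zero => simp [hH0]
  | succ n ih =>
    obtain ⟨w, hw⟩ := hne n v
    rw [hHrec, Ne, ENNReal.tsum_eq_zero]
    intro h
    have hfw : f n v w = 0 := by simpa [ih w] using h w
    exact hw hfw

theorem ENNReal.one_sub_add_le_mul (a b : ℝ≥0∞) : 1 - (a + b) ≤ (1 - a) * (1 - b) := by
  have ha : (1 - a) ≠ ⊤ := ENNReal.sub_ne_top ENNReal.one_ne_top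
  rw [ENNReal.mul_sub fun _ _ => ha, mul_one, ← tsub_tsub]
  exact tsub_le_tsub_left (mul_le_of_le_one_left' tsub_le_self) _

/-- A sequence which grows by a factor of at most `1 / (1 - ε n)` at step `n`, with `ε` summable
and each `ε n < 1`, is bounded. -/
theorem ENNReal.iSup_lt_top_of_one_sub_mul_le {S ε : ℕ → ℝ≥0∞} (hmono : Monotone S)
    (hS0 : S 0 ≠ ⊤) (hstep : ∀ n, (1 - ε n) * S (n + 1) ≤ S n) (hlt : ∀ n, ε n < 1)
    (hsum : ∑' n, ε n ≠ ⊤) : (⨆ n, S n) < ⊤ := by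
  have hfin : ∀ n, S n ≠ ⊤ := by
    intro n
    induction n with
    | zero => exact hS0
    | succ n ih =>
      intro htop
      have h := hstep n
      rw [htop, ENNReal.mul_top (tsub_pos_of_lt (hlt n)).ne'] at h
      exact ih (top_le_iff.1 h)
  obtain ⟨N, hN⟩ : ∃ N, ∑' k, ε (k + N) < 1 :=
    ((ENNReal.tendsto_sum_nat_add ε hsum).eventually_lt_const one_pos).exists
  have hprod : ∀ k, (1 - ∑ i ∈ Finset.range k, ε (i + N)) * S (k + N) ≤ S N := by
    intro k
    induction k with
    | zero => simp
    | succ k ih =>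
      rw [Finset.sum_range_succ, Nat.add_right_comm]
      calc _ ≤ (1 - ∑ i ∈ Finset.range k, ε (i + N)) * (1 - ε (k + N)) * S (k + N + 1) := by
            gcongr
            exact ENNReal.one_sub_add_le_mul _ _
        _ ≤ (1 - ∑ i ∈ Finset.range k, ε (i + N)) * S (k + N) := by
            rw [mul_assoc]
            gcongr
            exact hstep _
        _ ≤ S N := ih
  have hc : 1 - ∑' k, ε (k + N) ≠ 0 := (tsub_pos_of_lt hN).ne'
  have hbound : ∀ n, S n ≤ S N / (1 - ∑' k, ε (k + N)) := by
    intro n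
    refine (hmono (Nat.le_add_right n N)).trans ?_
    rw [ENNReal.le_div_iff_mul_le (Or.inl hc) (Or.inr (hfin N)), mul_comm]
    refine le_trans ?_ (hprod n)
    gcongr
    exact ENNReal.sum_le_tsum _
  exact (iSup_le hbound).trans_lt (ENNReal.div_lt_top (hfin N) hc)

/-- **Sufficient condition for finiteness of the measure extension in terms of the
stochastic incidence matrices** (Theorem 3.5).  If `ε n < 1` for all `n` and
`∑ ε n < ∞`, then every tail-invariant probability measure on the vertex
subdiagram has a finite extension. -/
theorem stmt_1
    (V : ℕ → Type) [∀ n, Countable (V n)] [∀ n, Nonempty (V n)]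
    (f : ∀ n, V (n + 1) → V n → ℕ)
    (hrow : ∀ (n : ℕ) (v : V (n + 1)),
      (Function.support (f n v)).Finite ∧ (Function.support (f n v)).Nonempty)
    (H : ∀ n, V n → ℝ≥0∞)
    (hH0 : ∀ v, H 0 v = 1)
    (hHrec : ∀ (n : ℕ) (v : V (n + 1)),
      H (n + 1) v = ∑' w : V n, (f n v w : ℝ≥0∞) * H n w)
    (W : ∀ n, Set (V n))
    (hWne : ∀ n, (W n).Nonempty)
    (hWadm : ∀ n, ∀ v ∈ W (n + 1), ∃ w ∈ W n, 0 < f n v w)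
    (q : ∀ n, V (n + 1) → V n → ℝ≥0∞)
    (hq : ∀ (n : ℕ) (v : V (n + 1)) (w : V n),
      q n v w = (f n v w : ℝ≥0∞) * H n w / H (n + 1) v)
    (ε : ℕ → ℝ≥0∞)
    (hε : ∀ n, ε n = ⨆ v : W (n + 1), ∑' w : ↥((W n)ᶜ), q n v.1 w.1)
    (hεlt : ∀ n, ε n < 1)
    (hεsum : ∑' n, ε n < ⊤) :
    ∀ p : ∀ n, V n → ℝ≥0∞,
      (∀ n, ∀ w ∈ W n,
        p n w = ∑' v : W (n + 1), (f n v.1 w : ℝ≥0∞) * p (n + 1) v.1) →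
      (∑' w : W 0, p 0 w.1 = 1) →
      (⨆ n, ∑' w : W n, H n w.1 * p n w.1) < ⊤ := by
  intro p hp hp0
  have hsplit : ∀ n (v : V (n + 1)), H (n + 1) v =
      ∑' w : W n, (f n v w.1 : ℝ≥0∞) * H n w.1 +
        ∑' w : ↥((W n)ᶜ), (f n v w.1 : ℝ≥0∞) * H n w.1 := by
    intro n v
    rw [hHrec]
    exact (ENNReal.summable.tsum_add_tsum_compl ENNReal.summable).symm
  have htop := height_ne_top V f (fun n v => (hrow n v).1) H hH0 hHrec
  have hzero := height_ne_zero V f (fun n v => (hrow n v).2) H hH0 hHrec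
  have hcompl : ∀ n, ∀ v : W (n + 1),
      ∑' w : ↥((W n)ᶜ), (f n v.1 w.1 : ℝ≥0∞) * H n w.1 ≤ ε n * H (n + 1) v.1 := by
    intro n v
    rw [← ENNReal.div_le_iff (hzero _ _) (htop _ _), hε, div_eq_mul_inv, ← ENNReal.tsum_mul_right]
    simp_rw [← div_eq_mul_inv, ← hq]
    exact le_iSup (fun v : W (n + 1) => ∑' w : ↥((W n)ᶜ), q n v.1 w.1) v
  have hinner : ∀ n, ∀ v : W (n + 1),
      (1 - ε n) * H (n + 1) v.1 ≤ ∑' w : W n, (f n v.1 w.1 : ℝ≥0∞) * H n w.1 := by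
    intro n v
    rw [ENNReal.sub_mul fun _ _ => htop _ _, one_mul, tsub_le_iff_right]
    exact (hsplit n v.1).le.trans (by gcongr; exact hcompl n v)
  have hexchange : ∀ n, ∑' w : W n, H n w.1 * p n w.1 =
      ∑' v : W (n + 1), (∑' w : W n, (f n v.1 w.1 : ℝ≥0∞) * H n w.1) * p (n + 1) v.1 := by
    intro n
    simp_rw [← ENNReal.tsum_mul_right]
    rw [ENNReal.tsum_comm]
    refine tsum_congr fun w => ?_
    rw [hp n w.1 w.2, ← ENNReal.tsum_mul_left]
    exact tsum_congr fun v => by ring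
  refine ENNReal.iSup_lt_top_of_one_sub_mul_le (ε := ε) (monotone_nat_of_le_succ fun n => ?_)
    ?_ (fun n => ?_) hεlt hεsum.ne
  · rw [hexchange n]
    gcongr with v
    exact le_self_add.trans (hsplit n v.1).ge
  · simp [hH0, hp0]
  · rw [hexchange n, ← ENNReal.tsum_mul_left]
    refine ENNReal.tsum_le_tsum fun v => ?_
    rw [← mul_assoc]
    gcongr
    exact hinner n v
end

section
/- Set Ŝ_n := ∑_{w∈V_n} H^(n)_w · p̄^(n)_w. Then Ŝ_0 = 1 and, for every n, Ŝ_{n+1} = Ŝ_n + ∑_{v∈V_{n+1}} ∑_{w∈V_n} (f^(n)_{v,w} − f̄^(n)_{v,w}) · H^(n)_w · p̄^(n+1)_v; consequently (Ŝ_n) is non-decreasing and the extension value satisfies V̂ = 1 + ∑_{n=0}^∞ ∑_{v∈V_{n+1}} ∑_{w∈V_n} (f^(n)_{v,w} − f̄^(n)_{v,w}) · H^(n)_w · p̄^(n+1)_v in [0,∞]. In particular V̂ < ∞ if and only if this triple series is finite. (Paper: Theorem 3.9, criterion for finiteness of the measure extension from an edge subdiagram.) -/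
open scoped ENNReal

/-- A sequence in `[0,∞]` with increments `D` has supremum `S 0 + ∑ D`. -/
theorem iSup_eq_add_tsum_of_succ_eq_add {S D : ℕ → ℝ≥0∞}
    (h : ∀ n, S (n + 1) = S n + D n) : ⨆ n, S n = S 0 + ∑' n, D n := by
  have hsum (n : ℕ) : S n = S 0 + ∑ k ∈ Finset.range n, D k := by
    induction n with
    | zero => simp
    | succ n ih => rw [h, ih, Finset.sum_range_succ, add_assoc]
  rw [ENNReal.tsum_eq_iSup_nat, ENNReal.add_iSup]
  exact iSup_congr hsum

/-- Weighted column sums of a matrix `f ≥ g` split into the part of `g` and the excess. -/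
theorem tsum_tsum_mul_eq_add_of_le {α β : Type*} {f g : β → α → ℕ}
    (hle : ∀ v w, g v w ≤ f v w) (h : α → ℝ≥0∞) (q : β → ℝ≥0∞) :
    ∑' v, (∑' w, (f v w : ℝ≥0∞) * h w) * q v =
      ∑' w, h w * ∑' v, (g v w : ℝ≥0∞) * q v +
        ∑' v, ∑' w, ((f v w - g v w : ℕ) : ℝ≥0∞) * h w * q v := by
  simp_rw [← ENNReal.tsum_mul_left]
  rw [ENNReal.tsum_comm (f := fun w v => h w * ((g v w : ℝ≥0∞) * q v)), ← ENNReal.tsum_add]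
  refine tsum_congr fun v => ?_
  rw [← ENNReal.tsum_add, ← ENNReal.tsum_mul_right]
  refine tsum_congr fun w => ?_
  have hf : (f v w : ℝ≥0∞) = g v w + ((f v w - g v w : ℕ) : ℝ≥0∞) := by
    rw [← Nat.cast_add, Nat.add_sub_cancel' (hle v w)]
  rw [hf]
  ring

/-- **Criterion for finiteness of the measure extension from an edge subdiagram**
(Theorem 3.9).  With `Ŝ n = ∑_{w ∈ V n} H n w * p̄ n w`, we have `Ŝ 0 = 1`, the
recursion `Ŝ (n+1) = Ŝ n + ∑_v ∑_w (f - f̄) H p̄`, monotonicity, and the extension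
value `⨆ n, Ŝ n = 1 + ∑ D n` is finite iff the triple series is. -/
theorem stmt_3
    (V : ℕ → Type) [∀ n, Countable (V n)] [∀ n, Nonempty (V n)]
    (f fbar : ∀ n, V (n + 1) → V n → ℕ)
    (hrow : ∀ (n : ℕ) (v : V (n + 1)),
      (Function.support (f n v)).Finite ∧ (Function.support (f n v)).Nonempty)
    (hle : ∀ (n : ℕ) (v : V (n + 1)) (w : V n), fbar n v w ≤ f n v w)
    (hbarrow : ∀ (n : ℕ) (v : V (n + 1)), ∃ w, 0 < fbar n v w)
    (H : ∀ n, V n → ℝ≥0∞)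
    (hH0 : ∀ v, H 0 v = 1)
    (hHrec : ∀ (n : ℕ) (v : V (n + 1)),
      H (n + 1) v = ∑' w : V n, (f n v w : ℝ≥0∞) * H n w)
    (p : ∀ n, V n → ℝ≥0∞)
    (hp : ∀ (n : ℕ) (w : V n),
      p n w = ∑' v : V (n + 1), (fbar n v w : ℝ≥0∞) * p (n + 1) v)
    (hp0 : ∑' w : V 0, p 0 w = 1)
    (S : ℕ → ℝ≥0∞)
    (hS : ∀ n, S n = ∑' w : V n, H n w * p n w)
    (D : ℕ → ℝ≥0∞)
    (hD : ∀ n, D n = ∑' v : V (n + 1), ∑' w : V n,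
        ((f n v w - fbar n v w : ℕ) : ℝ≥0∞) * H n w * p (n + 1) v) :
    S 0 = 1 ∧
    (∀ n, S (n + 1) = S n + D n) ∧
    Monotone S ∧
    (⨆ n, S n) = 1 + ∑' n, D n ∧
    ((⨆ n, S n) < ⊤ ↔ (∑' n, D n) < ⊤) := by
  have hS0 : S 0 = 1 := by simp [hS, hH0, hp0]
  have hsucc (n : ℕ) : S (n + 1) = S n + D n := by
    rw [hS, hS, hD]
    simp_rw [hHrec, hp n]
    exact tsum_tsum_mul_eq_add_of_le (hle n) (H n) (p (n + 1))
  have hsup : ⨆ n, S n = 1 + ∑' n, D n := by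
    rw [iSup_eq_add_tsum_of_succ_eq_add hsucc, hS0]
  refine ⟨hS0, hsucc, monotone_nat_of_le_succ fun n => ?_, hsup, ?_⟩
  · rw [hsucc]
    exact le_self_add
  · rw [hsup, ENNReal.add_lt_top]
    exact and_iff_right ENNReal.one_lt_top
end

section
/- Define a_n := sup_{v∈V_n} H^(n)_v / H̄^(n)_v and b_n := inf_{v∈V_n} H^(n)_v / H̄^(n)_v (values in [1,∞], since 1 ≤ H̄^(n)_v ≤ H^(n)_v). If ∑_{n=0}^∞ (a_{n+1} − b_n) < ∞ (in particular every a_n is finite), then for every encoded tail-invariant probability measure p̄ on the edge subdiagram the extension value V̂ is finite. (Paper: the theorem following Theorem 3.9 on edge subdiagrams, with a_n = sup H/H̄ and b_n = inf H/H̄.) -/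
open scoped ENNReal

/-- Heights computed along finitely supported rows are finite. -/
theorem height_ne_top_s4 {V : ℕ → Type} {g : ∀ n, V (n + 1) → V n → ℕ}
    (hg : ∀ n v, (Function.support (g n v)).Finite) {h : ∀ n, V n → ℝ≥0∞}
    (h0 : ∀ v, h 0 v = 1)
    (hrec : ∀ (n : ℕ) (v : V (n + 1)), h (n + 1) v = ∑' w : V n, (g n v w : ℝ≥0∞) * h n w)
    (n : ℕ) (v : V n) : h n v ≠ ⊤ := by
  induction n with
  | zero => simp [h0]
  | succ n ih =>
    rw [hrec, tsum_eq_sum (s := (hg n v).toFinset) fun w hw => by simp_all]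
    exact ENNReal.sum_ne_top.2 fun w _ => ENNReal.mul_ne_top (ENNReal.natCast_ne_top _) (ih w)

/-- The total mass `∑ h n w * p n w` of a tail-invariant measure does not depend on the level. -/
theorem tsum_height_mul_eq {V : ℕ → Type} {g : ∀ n, V (n + 1) → V n → ℕ}
    {h p : ∀ n, V n → ℝ≥0∞} (h0 : ∀ v, h 0 v = 1)
    (hrec : ∀ (n : ℕ) (v : V (n + 1)), h (n + 1) v = ∑' w : V n, (g n v w : ℝ≥0∞) * h n w)
    (hp : ∀ (n : ℕ) (w : V n), p n w = ∑' v : V (n + 1), (g n v w : ℝ≥0∞) * p (n + 1) v)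
    (n : ℕ) : ∑' w, h n w * p n w = ∑' w, p 0 w := by
  induction n with
  | zero => simp [h0]
  | succ n ih =>
    simp_rw [← ih, hrec, hp n, ← ENNReal.tsum_mul_right, ← ENNReal.tsum_mul_left]
    rw [ENNReal.tsum_comm]
    exact tsum_congr fun w => tsum_congr fun v => by ring

/-- A sequence whose increments over a smaller sequence are summable is bounded. -/
theorem le_add_tsum_tsub {a b : ℕ → ℝ≥0∞} (hab : ∀ n, b n ≤ a n) (n : ℕ) :
    a n ≤ a 0 + ∑' k, (a (k + 1) - b k) := by
  have hfin : a n ≤ a 0 + ∑ k ∈ Finset.range n, (a (k + 1) - b k) := by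
    induction n with
    | zero => simp
    | succ n ih =>
      rw [Finset.sum_range_succ, ← add_assoc]
      exact le_add_tsub.trans (add_le_add_left ((hab n).trans ih) _)
  exact hfin.trans (add_le_add_right (ENNReal.sum_le_tsum _) _)

/-- **Sufficient condition for finiteness of the measure extension from an edge
subdiagram** (the theorem following Theorem 3.9): if `∑ (a (n+1) - b n) < ∞`,
where `a n = sup_v H n v / H̄ n v` and `b n = inf_v H n v / H̄ n v` (each `a n`
finite), then every tail-invariant probability measure on the edge subdiagram
has a finite extension. -/
theorem stmt_4
    (V : ℕ → Type) [∀ n, Countable (V n)] [∀ n, Nonempty (V n)]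
    (f fbar : ∀ n, V (n + 1) → V n → ℕ)
    (hrow : ∀ (n : ℕ) (v : V (n + 1)),
      (Function.support (f n v)).Finite ∧ (Function.support (f n v)).Nonempty)
    (hle : ∀ (n : ℕ) (v : V (n + 1)) (w : V n), fbar n v w ≤ f n v w)
    (hbarrow : ∀ (n : ℕ) (v : V (n + 1)), ∃ w, 0 < fbar n v w)
    (H Hbar : ∀ n, V n → ℝ≥0∞)
    (hH0 : ∀ v, H 0 v = 1)
    (hHbar0 : ∀ v, Hbar 0 v = 1)
    (hHrec : ∀ (n : ℕ) (v : V (n + 1)),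
      H (n + 1) v = ∑' w : V n, (f n v w : ℝ≥0∞) * H n w)
    (hHbarrec : ∀ (n : ℕ) (v : V (n + 1)),
      Hbar (n + 1) v = ∑' w : V n, (fbar n v w : ℝ≥0∞) * Hbar n w)
    (a b : ℕ → ℝ≥0∞)
    (ha : ∀ n, a n = ⨆ v : V n, H n v / Hbar n v)
    (hb : ∀ n, b n = ⨅ v : V n, H n v / Hbar n v)
    (hafin : ∀ n, a n ≠ ⊤)
    (hsum : ∑' n, (a (n + 1) - b n) < ⊤) :
    ∀ p : ∀ n, V n → ℝ≥0∞,
      (∀ (n : ℕ) (w : V n),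
        p n w = ∑' v : V (n + 1), (fbar n v w : ℝ≥0∞) * p (n + 1) v) →
      (∑' w : V 0, p 0 w = 1) →
      (⨆ n, ∑' w : V n, H n w * p n w) < ⊤ := by
  intro p hp hp1
  have hab : ∀ n, b n ≤ a n := fun n => by
    rw [ha, hb]
    exact iInf_le_iSup
  have hbarfin : ∀ n v, (Function.support (fbar n v)).Finite := fun n v =>
    (hrow n v).1.subset fun w hw => (Nat.pos_of_ne_zero hw |>.trans_le (hle n v w)).ne'
  have hHle : ∀ n v, H n v ≤ a n * Hbar n v := fun n v => by
    rw [← ENNReal.div_le_iff_le_mul (.inr (hafin n))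
      (.inl (height_ne_top_s4 hbarfin hHbar0 hHbarrec n v)), ha]
    exact le_iSup (fun v => H n v / Hbar n v) v
  refine (iSup_le fun n => ?_).trans_lt
    (ENNReal.add_lt_top.2 ⟨(hafin 0).lt_top, hsum⟩)
  calc ∑' w, H n w * p n w ≤ ∑' w, a n * (Hbar n w * p n w) :=
        ENNReal.tsum_le_tsum fun w => by
          rw [← mul_assoc]
          exact mul_le_mul_left (hHle n w) _
    _ = a n := by
        rw [ENNReal.tsum_mul_left, tsum_height_mul_eq hHbar0 hHbarrec hp, hp1, mul_one]
    _ ≤ _ := le_add_tsum_tsub hab n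
end

section
/- Assume in addition that the full diagram has equal row sums, ∑_{w∈V_n} f^(n)_{v,w} = r_n for every v ∈ V_{n+1}, where r_n are positive integers, and that for every n there is a nonempty subset W'_n ⊆ V_n∖W with f^(n)_{v,w} ≥ 1 for every v ∈ W and every w ∈ W'_n. Then the extension value of the Perron measure is infinite: V̂ = ∞. (Paper: Proposition 4.6 — when the ambient diagram has the ERS property, the Perron measure on a stationary subdiagram always has infinite extension.) -/
open scoped ENNReal

/-- In a diagram with equal row sums `r n`, all heights on level `n` equal `∏ i < n, r i`. -/
theorem height_eq_prod_of_equal_row_sums {V : Type*} {f : ℕ → V → V → ℕ} {H : ℕ → V → ℝ≥0∞}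
    {r : ℕ → ℕ} (hH0 : ∀ v, H 0 v = 1)
    (hHrec : ∀ (n : ℕ) (v : V), H (n + 1) v = ∑' w : V, (f n v w : ℝ≥0∞) * H n w)
    (hERS : ∀ (n : ℕ) (v : V), ∑' w : V, (f n v w : ℝ≥0∞) = (r n : ℝ≥0∞)) (n : ℕ) (v : V) :
    H n v = ∏ i ∈ Finset.range n, (r i : ℝ≥0∞) := by
  induction n generalizing v with
  | zero => simp [hH0]
  | succ n ih =>
    simp_rw [hHrec, ih, ENNReal.tsum_mul_right, hERS, Finset.prod_range_succ, mul_comm]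

/-- An eigenvalue of the transpose of a nonnegative matrix with a probability eigenvector is
at most any uniform bound on the row sums. -/
theorem eigenvalue_le_of_row_sum_le {ι : Type*} {a : ι → ι → ℝ≥0∞} {ξ : ι → ℝ≥0∞}
    {lam c : ℝ≥0∞} (hsum : ∑' v, ξ v = 1) (heig : ∀ w, ∑' v, a v w * ξ v = lam * ξ w)
    (hrow : ∀ v, ∑' w, a v w ≤ c) : lam ≤ c :=
  calc
    lam = ∑' w, ∑' v, a v w * ξ v := by simp_rw [heig, ENNReal.tsum_mul_left, hsum, mul_one]
    _ = ∑' v, (∑' w, a v w) * ξ v := by rw [ENNReal.tsum_comm]; simp_rw [ENNReal.tsum_mul_right]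
    _ ≤ ∑' v, c * ξ v := ENNReal.tsum_le_tsum fun v ↦ by gcongr; exact hrow v
    _ = c := by rw [ENNReal.tsum_mul_left, hsum, mul_one]

/-- **Infinite extension of the Perron measure from a stationary subdiagram of an
ERS diagram** (Proposition 4.6).  If the ambient diagram has equal row sums `r n`
and on each level there is a nonempty set `W'_n ⊆ Wᶜ` of vertices all connected to
every vertex of `W`, then the extension value of the Perron measure is infinite. -/
theorem stmt_10
    (V : Type) [Countable V] [Nonempty V]
    (f : ℕ → V → V → ℕ)
    (hrow : ∀ (n : ℕ) (v : V),
      (Function.support (f n v)).Finite ∧ (Function.support (f n v)).Nonempty)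
    (H : ℕ → V → ℝ≥0∞)
    (hH0 : ∀ v, H 0 v = 1)
    (hHrec : ∀ (n : ℕ) (v : V), H (n + 1) v = ∑' w : V, (f n v w : ℝ≥0∞) * H n w)
    -- stationary vertex subdiagram on W
    (W : Set V) (hWne : W.Nonempty)
    (fbar : V → V → ℕ)
    (hstat : ∀ n, ∀ v ∈ W, ∀ w ∈ W, f n v w = fbar v w)
    (hbarrow : ∀ v ∈ W, ∃ w ∈ W, 0 < fbar v w)
    (hbarcol : ∀ w ∈ W, ∃ v ∈ W, 0 < fbar v w)
    -- normalized Perron eigenpair for the transpose of f̄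
    (lam : ℝ≥0∞) (hlam1 : 1 < lam) (hlamtop : lam ≠ ⊤)
    (ξ : V → ℝ≥0∞)
    (hξsum : ∑' v : W, ξ v.1 = 1)
    (hξeig : ∀ w ∈ W, ∑' v : W, (fbar v.1 w : ℝ≥0∞) * ξ v.1 = lam * ξ w)
    -- equal row sums
    (r : ℕ → ℕ) (hrpos : ∀ n, 1 ≤ r n)
    (hERS : ∀ (n : ℕ) (v : V), ∑' w : V, (f n v w : ℝ≥0∞) = (r n : ℝ≥0∞))
    -- nonempty exterior sets fully connected to W
    (hW' : ∀ n : ℕ, ∃ W' : Set V, W'.Nonempty ∧ W' ⊆ Wᶜ ∧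
      ∀ v ∈ W, ∀ w ∈ W', 1 ≤ f n v w)
    (Vhat : ℝ≥0∞)
    (hVhat : Vhat = 1 + ∑' n : ℕ, ∑' v : ↥W, ∑' w : ↥Wᶜ,
        (f n v.1 w.1 : ℝ≥0∞) * H n w.1 * ξ v.1 / lam ^ (n + 1)) :
    Vhat = ⊤ := by
  have hlam_le (n : ℕ) : lam ≤ r n := by
    refine eigenvalue_le_of_row_sum_le (a := fun v w : W ↦ (fbar v w : ℝ≥0∞)) hξsum
      (fun w ↦ hξeig w w.2) fun v ↦ ?_
    simp_rw [← hERS n v, ← hstat n v v.2 _ (Subtype.coe_prop _)]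
    exact ENNReal.tsum_comp_le_tsum_of_injective Subtype.val_injective
      fun w ↦ (f n v w : ℝ≥0∞)
  have hpow_le (n : ℕ) (v : V) : lam ^ n ≤ H n v := by
    rw [height_eq_prod_of_equal_row_sums hH0 hHrec hERS]
    simpa using Finset.prod_le_prod' (s := Finset.range n) fun i _ ↦ hlam_le i
  have hlam0 : lam ≠ 0 := (zero_lt_one.trans hlam1).ne'
  have hterm (n : ℕ) : lam⁻¹ ≤ ∑' v : ↥W, ∑' w : ↥Wᶜ,
      (f n v.1 w.1 : ℝ≥0∞) * H n w.1 * ξ v.1 / lam ^ (n + 1) := by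
    obtain ⟨W', ⟨w, hw⟩, hW'sub, hW'f⟩ := hW' n
    calc
      lam⁻¹ = lam ^ n / lam ^ (n + 1) := by
        rw [pow_succ, div_eq_mul_inv, ENNReal.mul_inv (.inr hlamtop) (.inr hlam0), ← mul_assoc,
          ENNReal.mul_inv_cancel (pow_ne_zero n hlam0) (ENNReal.pow_ne_top hlamtop), one_mul]
      _ = ∑' v : W, 1 * lam ^ n * ξ v / lam ^ (n + 1) := by
        simp_rw [div_eq_mul_inv, ENNReal.tsum_mul_right, ENNReal.tsum_mul_left, hξsum, one_mul,
          mul_one]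
      _ ≤ ∑' v : W, (f n v w : ℝ≥0∞) * H n w * ξ v / lam ^ (n + 1) := by
        gcongr with v
        · exact_mod_cast hW'f v v.2 w hw
        · exact hpow_le n w
      _ ≤ _ := ENNReal.tsum_le_tsum fun v ↦ ENNReal.le_tsum (⟨w, hW'sub hw⟩ : ↥Wᶜ)
  have htop : ∑' _ : ℕ, lam⁻¹ = ⊤ :=
    ENNReal.tsum_const_eq_top_of_ne_zero (ENNReal.inv_ne_zero.2 hlamtop)
  rw [hVhat, top_le_iff.1 (htop.symm.le.trans (ENNReal.tsum_le_tsum hterm)), add_top]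
end

section
/- Let X be a measurable space, μ a probability measure on X, and (μ_n)_{n∈ℕ} measures on X with μ_n(X) ≤ 1 for all n (subprobability measures). Let (C_i)_{i∈ℕ} be measurable subsets of X such that ⋃_i C_i = X and any two of the sets C_i are either disjoint or one is contained in the other (the nesting property of cylinder sets of a Bratteli diagram). If lim_{n→∞} μ_n(C_i) = μ(C_i) for every i, then lim_{n→∞} μ_n(X) = μ(X) = 1. (Paper: Proposition 9.2, convergence on cylinder sets of subprobability measures implies convergence of total masses.) -/
open MeasureTheory Filter Topology

/-- A finite family of sets, any two of which are disjoint or nested, has a pairwise disjoint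
subfamily with the same union. -/
theorem exists_subset_pairwiseDisjoint_biUnion_eq {ι X : Type*} (C : ι → Set X)
    (hnest : ∀ i j, Disjoint (C i) (C j) ∨ C i ⊆ C j ∨ C j ⊆ C i) (s : Finset ι) :
    ∃ t ⊆ s, (t : Set ι).PairwiseDisjoint C ∧ ⋃ i ∈ t, C i = ⋃ i ∈ s, C i := by
  classical
  induction s using Finset.induction_on with
  | empty => exact ⟨∅, subset_rfl, by simp, rfl⟩
  | insert a s ha ih =>
    obtain ⟨t, hts, hdisj, hunion⟩ := ih
    by_cases h : ∃ j ∈ t, C a ⊆ C j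
    · obtain ⟨j, hj, haj⟩ := h
      refine ⟨t, hts.trans (Finset.subset_insert a s), hdisj, ?_⟩
      rw [Finset.set_biUnion_insert, ← hunion, eq_comm, Set.union_eq_right]
      exact haj.trans (Set.subset_biUnion_of_mem (u := C) hj)
    · push Not at h
      refine ⟨insert a (t.filter fun j => Disjoint (C a) (C j)),
        Finset.insert_subset_insert a ((Finset.filter_subset _ t).trans hts), ?_, ?_⟩
      · rw [Finset.coe_insert, Set.pairwiseDisjoint_insert]
        refine ⟨hdisj.subset (Finset.coe_subset.2 (Finset.filter_subset _ t)), fun j hj _ => ?_⟩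
        exact (Finset.mem_filter.1 hj).2
      · rw [Finset.set_biUnion_insert, Finset.set_biUnion_insert, ← hunion]
        apply Set.Subset.antisymm
        · exact Set.union_subset_union_right _
            (Set.biUnion_subset_biUnion_left (Finset.filter_subset _ t))
        · refine Set.union_subset Set.subset_union_left (Set.iUnion₂_subset fun j hj => ?_)
          rcases hnest a j with hd | haj | hja
          · exact (Set.subset_biUnion_of_mem (u := C)
              (Finset.mem_filter.2 ⟨hj, hd⟩)).trans Set.subset_union_right
          · exact absurd haj (h j hj)
          · exact hja.trans Set.subset_union_left

/-- Convergence of measures on the members of a family of measurable sets, any two of which are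
disjoint or nested, implies convergence on finite unions of members of the family. -/
theorem tendsto_measure_biUnion_finset_of_nested {α ι X : Type*} [MeasurableSpace X]
    {l : Filter α} {μ : Measure X} {μs : α → Measure X} {C : ι → Set X}
    (hmeas : ∀ i, MeasurableSet (C i))
    (hnest : ∀ i j, Disjoint (C i) (C j) ∨ C i ⊆ C j ∨ C j ⊆ C i)
    (hconv : ∀ i, Tendsto (fun n => μs n (C i)) l (𝓝 (μ (C i)))) (s : Finset ι) :
    Tendsto (fun n => μs n (⋃ i ∈ s, C i)) l (𝓝 (μ (⋃ i ∈ s, C i))) := by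
  obtain ⟨t, -, hdisj, hunion⟩ := exists_subset_pairwiseDisjoint_biUnion_eq C hnest s
  simp only [← hunion, measure_biUnion_finset hdisj fun i _ => hmeas i]
  exact tendsto_finsetSum t fun i _ => hconv i

/-- **Convergence on cylinder sets of subprobability measures implies convergence
of total masses** (Proposition 9.2).  If subprobability measures `μs n` converge
on every cylinder set `C i` (the `C i` cover `X` and any two of them are disjoint
or nested) to a probability measure `μ`, then `μs n X → μ X = 1`. -/
theorem stmt_19
    {X : Type*} [MeasurableSpace X]
    (μ : MeasureTheory.Measure X) [MeasureTheory.IsProbabilityMeasure μ]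
    (μs : ℕ → MeasureTheory.Measure X)
    (hsub : ∀ n, μs n Set.univ ≤ 1)
    (C : ℕ → Set X)
    (hmeas : ∀ i, MeasurableSet (C i))
    (hcover : ⋃ i, C i = Set.univ)
    (hnest : ∀ i j, Disjoint (C i) (C j) ∨ C i ⊆ C j ∨ C j ⊆ C i)
    (hconv : ∀ i, Filter.Tendsto (fun n => μs n (C i)) Filter.atTop (nhds (μ (C i)))) :
    Filter.Tendsto (fun n => μs n Set.univ) Filter.atTop (nhds (μ Set.univ)) ∧
    μ Set.univ = 1 := by
  refine ⟨tendsto_order.2 ⟨fun a ha => ?_, fun a ha => ?_⟩, measure_univ⟩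
  · have hacc : Tendsto (fun N => μ (Set.accumulate C N)) atTop (𝓝 (μ Set.univ)) :=
      hcover ▸ tendsto_measure_iUnion_accumulate
    obtain ⟨N, hN⟩ := (hacc.eventually_const_lt ha).exists
    have hfin : Set.accumulate C N = ⋃ i ∈ Finset.Iic N, C i := by
      simp [Set.accumulate_def]
    rw [hfin] at hN
    filter_upwards [(tendsto_measure_biUnion_finset_of_nested hmeas hnest hconv
      (Finset.Iic N)).eventually_const_lt hN] with n hn
    exact hn.trans_le (measure_mono (Set.subset_univ _))
  · rw [measure_univ] at ha
    exact Eventually.of_forall fun n => (hsub n).trans_lt ha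
end
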